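/- (Theorem 1.2, rate function for centered compound Poisson moments.) Define the centered moments M̃_k(x) = Σ_{r=0}^k C(k,r)·M_r(x)·(−x·V_1)^{k−r} and set H̃(u) = H(u) − u·V_1. Assume V_i ≥ 0 for all i ≥ 1, V_2 > 0 and V_3 > 0, and H(u) < ∞ for all u ∈ [0, u_0). Let χ > 0 and suppose u ∈ (0, u_0) satisfies u·H̃'(u) = 1/χ. Then for every sequence (x_k)_{k≥1} of positive reals with x_k/k → χ as k → ∞, one has (1/k)·ln( M̃_k(x_k)/x_k^k ) → ( H̃(u) − 1 )/( u·H̃'(u) ) − 1 + ln H̃'(u) as k → ∞. -/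

import Mathlib

open scoped BigOperators ENNReal
open Filter MeasureTheory

noncomputable section

/-- The finset of tuples `(l 0, ..., l (k-1))` (representing `l_1, ..., l_k`) of nonnegative
integers with `l_1 + 2 l_2 + ⋯ + k l_k = k`. -/
def bellTuples (k : ℕ) : Finset (Fin k → ℕ) :=
  (Fintype.piFinset fun _ => Finset.range (k + 1)).filter
    (fun l => ∑ i, (i.1 + 1) * l i = k)

/-- Weighted Bell polynomial `M_k(x)` for weights `V_1, V_2, …`. -/
def weightedBell (V : ℕ → ℝ) (k : ℕ) (x : ℝ) : ℝ :=
  (Nat.factorial k : ℝ) * ∑ l ∈ bellTuples k, ∏ i : Fin k,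
    (x * V (i.1 + 1)) ^ (l i) /
      ((Nat.factorial (i.1 + 1) : ℝ) ^ (l i) * (Nat.factorial (l i) : ℝ))

/-- Exponential generating function `H(u) = 1 + ∑_{i ≥ 1} V_i u^i / i!` of the weights. -/
def weightEGF (V : ℕ → ℝ) (u : ℝ) : ℝ :=
  1 + ∑' i : ℕ, V (i + 1) * u ^ (i + 1) / (Nat.factorial (i + 1) : ℝ)

/-- Termwise derivative `H'(u) = ∑_{i ≥ 1} V_i u^{i-1}/(i-1)!`. -/
def weightEGFDeriv (V : ℕ → ℝ) (u : ℝ) : ℝ :=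
  ∑' i : ℕ, V (i + 1) * u ^ i / (Nat.factorial i : ℝ)

/-- Termwise second derivative `H''(u)`. -/
def weightEGFDeriv2 (V : ℕ → ℝ) (u : ℝ) : ℝ :=
  ∑' i : ℕ, V (i + 2) * u ^ i / (Nat.factorial i : ℝ)

/-- `H(u) < ∞` for all `u ∈ [0, u_0)`. -/
def HFinite (V : ℕ → ℝ) (u0 : ℝ≥0∞) : Prop :=
  ∀ u : ℝ, 0 ≤ u → ENNReal.ofReal u < u0 →
    Summable (fun i : ℕ => V (i + 1) * u ^ (i + 1) / (Nat.factorial (i + 1) : ℝ))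

/-- Centered moments `M̃_k(x) = ∑_{r=0}^k C(k,r) M_r(x) (−x V_1)^{k−r}`. -/
def centeredBell (V : ℕ → ℝ) (k : ℕ) (x : ℝ) : ℝ :=
  ∑ r ∈ Finset.range (k + 1),
    (Nat.choose k r : ℝ) * weightedBell V r x * (-(x * V 1)) ^ (k - r)

/-- The power series `exp (a * z ^ m)`. -/
def expMonomial (m : ℕ) (a : ℝ) : PowerSeries ℝ :=
  PowerSeries.mk fun n => if m ∣ n then a ^ (n / m) / (Nat.factorial (n / m) : ℝ) else 0

/-- The power series `exp (x * ∑_{1 ≤ i ≤ K} V_i z ^ i / i!)`. -/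
def bellSeries (V : ℕ → ℝ) (x : ℝ) (K : ℕ) : PowerSeries ℝ :=
  ∏ i ∈ Finset.range K, expMonomial (i + 1) (x * V (i + 1) / (Nat.factorial (i + 1) : ℝ))

/-- The summand of the weighted Bell polynomial at a tuple `l`. -/
def bellTerm (V : ℕ → ℝ) (x : ℝ) (i l : ℕ) : ℝ :=
  (x * V (i + 1)) ^ l / ((Nat.factorial (i + 1) : ℝ) ^ l * (Nat.factorial l : ℝ))

lemma bellTerm_eq (V : ℕ → ℝ) (x : ℝ) (i l : ℕ) :
    bellTerm V x i l =
      (x * (V (i + 1) / (Nat.factorial (i + 1) : ℝ))) ^ l / (Nat.factorial l : ℝ) := by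
  rw [bellTerm, ← mul_div_assoc, div_pow, div_div]

lemma coeff_expMonomial (m : ℕ) (a : ℝ) (n : ℕ) :
    PowerSeries.coeff n (expMonomial m a) =
      if m ∣ n then a ^ (n / m) / (Nat.factorial (n / m) : ℝ) else 0 :=
  PowerSeries.coeff_mk _ _

lemma expMonomial_zero_right {m : ℕ} (hm : 0 < m) : expMonomial m 0 = 1 := by
  ext n
  rw [coeff_expMonomial, PowerSeries.coeff_one]
  rcases Nat.eq_zero_or_pos n with rfl | hn
  · simp
  · split_ifs with h h'
    · omega
    · have : n / m ≠ 0 := (Nat.div_pos (Nat.le_of_dvd hn h) hm).ne'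
      simp [this]
    · omega
    · rfl

lemma expMonomial_one (a : ℝ) :
    expMonomial 1 a = PowerSeries.rescale a (PowerSeries.exp ℝ) := by
  ext n
  simp [coeff_expMonomial, PowerSeries.coeff_rescale, PowerSeries.coeff_exp, div_eq_mul_inv]

lemma expMonomial_one_mul_neg (a : ℝ) : expMonomial 1 a * expMonomial 1 (-a) = 1 := by
  rw [expMonomial_one, expMonomial_one, PowerSeries.exp_mul_exp_eq_exp_add, add_neg_cancel,
    ← expMonomial_one, expMonomial_zero_right one_pos]

lemma coeff_mul_expMonomial_of_lt (P : PowerSeries ℝ) {r m : ℕ} (h : r < m) (a : ℝ) :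
    PowerSeries.coeff r (P * expMonomial m a) = PowerSeries.coeff r P := by
  rw [PowerSeries.coeff_mul, Finset.sum_eq_single (r, 0)]
  · simp [coeff_expMonomial]
  · rintro ⟨i, j⟩ hij hne
    have hij : i + j = r := Finset.HasAntidiagonal.mem_antidiagonal.mp hij
    have hj : 0 < j := by
      rcases Nat.eq_zero_or_pos j with rfl | hj
      · exact absurd (by simpa using hij) (by simpa using hne)
      · exact hj
    have : ¬ m ∣ j := fun hd => by
      have := Nat.le_of_dvd hj hd
      omega
    simp [coeff_expMonomial, this]
  · simp

lemma coeff_bellSeries_of_le (V : ℕ → ℝ) (x : ℝ) {r K : ℕ} (h : r ≤ K) :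
    PowerSeries.coeff r (bellSeries V x K) = PowerSeries.coeff r (bellSeries V x r) := by
  induction K, h using Nat.le_induction with
  | base => rfl
  | succ n hn ih =>
    rw [← ih]
    simp only [bellSeries]
    rw [Finset.prod_range_succ, coeff_mul_expMonomial_of_lt _ (by omega)]

lemma weightedBell_eq_sum_bellTerm (V : ℕ → ℝ) (k : ℕ) (x : ℝ) :
    weightedBell V k x =
      (Nat.factorial k : ℝ) * ∑ l ∈ bellTuples k, ∏ i : Fin k, bellTerm V x i (l i) :=
  rfl

lemma weightedBell_eq_coeff_self (V : ℕ → ℝ) (k : ℕ) (x : ℝ) :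
    weightedBell V k x =
      (Nat.factorial k : ℝ) * PowerSeries.coeff k (bellSeries V x k) := by
  rw [weightedBell_eq_sum_bellTerm, bellSeries, Finset.prod_range, PowerSeries.coeff_prod]
  congr 1
  refine Finset.sum_of_injOn
    (fun l => Finsupp.equivFunOnFinite.symm fun i : Fin k => (i.1 + 1) * l i) ?_ ?_ ?_ ?_
  · intro l _ l' _ h
    have h' := Finsupp.equivFunOnFinite.symm.injective h
    funext i
    have := congrFun h' i
    exact Nat.eq_of_mul_eq_mul_left (Nat.succ_pos _) this
  · intro l hl
    simp only [bellTuples, Finset.coe_filter, Set.mem_ofPred_eq] at hl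
    simp [Finset.mem_finsuppAntidiag, hl.2]
  · intro f hf hnot
    rw [Finset.mem_finsuppAntidiag] at hf
    by_contra hne
    have hdvd : ∀ i : Fin k, (i.1 + 1) ∣ f i := fun i => by
      by_contra hi
      exact hne (Finset.prod_eq_zero (Finset.mem_univ i) (by simp [coeff_expMonomial, hi]))
    choose l hl using hdvd
    apply hnot
    refine ⟨l, ?_, ?_⟩
    · have hsum : ∑ i, (i.1 + 1) * l i = k := by
        exact (Finset.sum_congr rfl fun i _ => (hl i).symm).trans hf.1
      simp only [bellTuples, Finset.coe_filter, Set.mem_ofPred_eq, Fintype.mem_piFinset,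
        Finset.mem_range]
      refine ⟨fun i => ?_, hsum⟩
      have := Finset.single_le_sum (f := fun i : Fin k => (i.1 + 1) * l i)
        (fun _ _ => Nat.zero_le _) (Finset.mem_univ i)
      rw [hsum] at this
      nlinarith
    · ext i
      simp [hl i]
  · intro l _
    refine Finset.prod_congr rfl fun i _ => ?_
    simp [coeff_expMonomial, bellTerm_eq, mul_div_assoc]

lemma weightedBell_eq_coeff (V : ℕ → ℝ) {k K : ℕ} (h : k ≤ K) (x : ℝ) :
    weightedBell V k x =
      (Nat.factorial k : ℝ) * PowerSeries.coeff k (bellSeries V x K) := by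
  rw [coeff_bellSeries_of_le V x h, weightedBell_eq_coeff_self]

lemma bellSeries_mul_expMonomial_neg (V : ℕ → ℝ) (x : ℝ) (K : ℕ) :
    bellSeries V x (K + 1) * expMonomial 1 (-(x * V 1)) =
      bellSeries (Function.update V 1 0) x (K + 1) := by
  simp only [bellSeries, Finset.prod_range_succ' _ K]
  simp [mul_assoc, expMonomial_one_mul_neg, expMonomial_zero_right]

/-- Centering amounts to discarding the first weight. -/
lemma centeredBell_eq_weightedBell (V : ℕ → ℝ) (k : ℕ) (x : ℝ) :
    centeredBell V k x = weightedBell (Function.update V 1 0) k x := by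
  rw [weightedBell_eq_coeff _ (Nat.le_succ k), ← bellSeries_mul_expMonomial_neg,
    PowerSeries.coeff_mul, Finset.Nat.sum_antidiagonal_eq_sum_range_succ_mk, Finset.mul_sum,
    centeredBell]
  refine Finset.sum_congr rfl fun r hr => ?_
  have hrk : r ≤ k := Nat.lt_succ_iff.mp (Finset.mem_range.mp hr)
  rw [weightedBell_eq_coeff V (hrk.trans (Nat.le_succ k)), Nat.cast_choose ℝ hrk]
  simp only [coeff_expMonomial, one_dvd, if_true, Nat.div_one]
  have h1 := Nat.cast_ne_zero (R := ℝ).mpr (Nat.factorial_ne_zero r)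
  have h2 := Nat.cast_ne_zero (R := ℝ).mpr (Nat.factorial_ne_zero (k - r))
  field_simp

lemma bellTerm_nonneg {V : ℕ → ℝ} (hV : ∀ i, 0 ≤ V (i + 1)) {x : ℝ} (hx : 0 ≤ x) (i l : ℕ) :
    0 ≤ bellTerm V x i l := by
  have := hV i
  unfold bellTerm
  positivity

lemma weightedBell_mul_pow_le {V : ℕ → ℝ} (hV : ∀ i, 0 ≤ V (i + 1)) {x u : ℝ} (hx : 0 ≤ x)
    (hu : 0 ≤ u) (k : ℕ) :
    weightedBell V k x * u ^ k ≤ (Nat.factorial k : ℝ) * Real.exp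
      (x * ∑ i ∈ Finset.range k, V (i + 1) * u ^ (i + 1) / (Nat.factorial (i + 1) : ℝ)) := by
  rw [weightedBell_eq_sum_bellTerm, mul_assoc]
  gcongr
  have hnn : ∀ i, 0 ≤ x * (V (i + 1) * u ^ (i + 1) / (Nat.factorial (i + 1) : ℝ)) := fun i => by
    have := hV i
    positivity
  calc
    _ = ∑ l ∈ bellTuples k, ∏ i : Fin k,
        (x * (V (i + 1) * u ^ (i.1 + 1) / (Nat.factorial (i.1 + 1) : ℝ))) ^ l i /
          (Nat.factorial (l i) : ℝ) := by
      rw [Finset.sum_mul]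
      refine Finset.sum_congr rfl fun l hl => ?_
      have hl' : ∑ i, (i.1 + 1) * l i = k := (Finset.mem_filter.mp hl).2
      have hu' : u ^ k = ∏ i : Fin k, u ^ ((i.1 + 1) * l i) := by
        rw [Finset.prod_pow_eq_pow_sum, hl']
      rw [hu', ← Finset.prod_mul_distrib]
      refine Finset.prod_congr rfl fun i _ => ?_
      rw [bellTerm_eq, pow_mul, div_mul_eq_mul_div, ← mul_pow]
      congr 2
      ring
    _ ≤ ∑ l ∈ Fintype.piFinset fun _ : Fin k => Finset.range (k + 1), ∏ i : Fin k,
        (x * (V (i + 1) * u ^ (i.1 + 1) / (Nat.factorial (i.1 + 1) : ℝ))) ^ l i /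
          (Nat.factorial (l i) : ℝ) := by
      refine Finset.sum_le_sum_of_subset_of_nonneg (Finset.filter_subset _ _) fun l _ _ => ?_
      exact Finset.prod_nonneg fun i _ => div_nonneg (pow_nonneg (hnn i) _) (Nat.cast_nonneg _)
    _ = ∏ i : Fin k, ∑ j ∈ Finset.range (k + 1),
        (x * (V (i + 1) * u ^ (i.1 + 1) / (Nat.factorial (i.1 + 1) : ℝ))) ^ j /
          (Nat.factorial j : ℝ) := by
      rw [Finset.prod_univ_sum]
    _ ≤ ∏ i : Fin k,
        Real.exp (x * (V (i + 1) * u ^ (i.1 + 1) / (Nat.factorial (i.1 + 1) : ℝ))) := by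
      refine Finset.prod_le_prod (fun i _ => Finset.sum_nonneg fun j _ =>
        div_nonneg (pow_nonneg (hnn i) _) (Nat.cast_nonneg _)) fun i _ => ?_
      exact Real.sum_le_exp_of_nonneg (hnn i) _
    _ = _ := by
      rw [← Real.exp_sum, Finset.mul_sum, Finset.sum_range]

lemma prod_bellTerm_le_weightedBell {V : ℕ → ℝ} (hV : ∀ i, 0 ≤ V (i + 1)) {x : ℝ} (hx : 0 ≤ x)
    {k K : ℕ} (hK : K ≤ k) (l : ℕ → ℕ) (hl : ∑ i ∈ Finset.range K, (i + 1) * l i = k) :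
    (Nat.factorial k : ℝ) * ∏ i ∈ Finset.range K, bellTerm V x i (l i) ≤
      weightedBell V k x := by
  rw [weightedBell_eq_sum_bellTerm]
  gcongr
  set l' : ℕ → ℕ := fun i => if i < K then l i else 0 with hl'_def
  have hsum : ∑ i : Fin k, (i.1 + 1) * l' i = k := by
    rw [← Finset.sum_range fun i => (i + 1) * l' i]
    conv_rhs => rw [← hl]
    symm
    apply Finset.sum_subset_zero_on_sdiff (Finset.range_subset_range.mpr hK)
    · intro i hi
      simp only [Finset.mem_sdiff, Finset.mem_range, not_lt] at hi
      simp [hl'_def, hi.2]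
    · intro i hi
      simp [hl'_def, Finset.mem_range.mp hi]
  have hprod : ∏ i ∈ Finset.range K, bellTerm V x i (l i) =
      ∏ i : Fin k, bellTerm V x i (l' i) := by
    rw [← Finset.prod_range fun i => bellTerm V x i (l' i)]
    apply Finset.prod_subset_one_on_sdiff (Finset.range_subset_range.mpr hK)
    · intro i hi
      simp only [Finset.mem_sdiff, Finset.mem_range, not_lt] at hi
      simp [hl'_def, hi.2.not_gt, bellTerm]
    · intro i hi
      simp [hl'_def, Finset.mem_range.mp hi]
  rw [hprod]
  refine Finset.single_le_sum (f := fun l : Fin k → ℕ => ∏ i : Fin k, bellTerm V x i (l i))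
    (fun l _ => Finset.prod_nonneg fun i _ => bellTerm_nonneg hV hx _ _)
    (a := fun i : Fin k => l' i) ?_
  refine Finset.mem_filter.mpr ⟨Fintype.mem_piFinset.mpr fun i => Finset.mem_range.mpr ?_, hsum⟩
  have := Finset.single_le_sum (f := fun i : Fin k => (i.1 + 1) * l' i)
    (fun _ _ => Nat.zero_le _) (Finset.mem_univ i)
  rw [hsum] at this
  nlinarith

lemma mul_log_sub_le_log_factorial (n : ℕ) :
    (n : ℝ) * Real.log n - n ≤ Real.log (Nat.factorial n) := by
  rcases Nat.eq_zero_or_pos n with rfl | hn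
  · simp
  have hn' : (0 : ℝ) < n := Nat.cast_pos.mpr hn
  have h := Real.pow_div_factorial_le_exp (n : ℝ) hn'.le n
  have hf : (0 : ℝ) < Nat.factorial n := Nat.cast_pos.mpr (Nat.factorial_pos n)
  have h2 := Real.log_le_log (by positivity) h
  rw [Real.log_exp, Real.log_div (by positivity) hf.ne', Real.log_pow] at h2
  linarith

lemma log_factorial_le {n : ℕ} (hn : 1 ≤ n) :
    Real.log (Nat.factorial n) ≤ (n : ℝ) * Real.log n - n + Real.log n + 1 := by
  induction n, hn using Nat.le_induction with
  | base => simp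
  | succ n hn ih =>
    have hn' : (0 : ℝ) < n := Nat.cast_pos.mpr hn
    have hf : (0 : ℝ) < Nat.factorial n := Nat.cast_pos.mpr (Nat.factorial_pos n)
    rw [Nat.factorial_succ, Nat.cast_mul, Real.log_mul (by positivity) hf.ne']
    have h := Real.log_le_sub_one_of_pos (x := (n : ℝ) / (n + 1)) (by positivity)
    rw [Real.log_div hn'.ne' (by positivity)] at h
    have h3 : ((n : ℝ) + 1) * (n / (n + 1) - 1) = -1 := by field_simp; ring
    have h4 := mul_le_mul_of_nonneg_left h (by positivity : (0 : ℝ) ≤ n + 1)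
    rw [h3] at h4
    push_cast
    linarith

lemma log_factorial_sub_le (n : ℕ) :
    Real.log (Nat.factorial n) - ((n : ℝ) * Real.log n - n) ≤ 2 * √n + 1 := by
  rcases Nat.eq_zero_or_pos n with rfl | hn
  · simp
  have hn' : (0 : ℝ) < n := Nat.cast_pos.mpr hn
  have h1 := log_factorial_le hn
  have h2 := Real.log_le_sub_one_of_pos (Real.sqrt_pos.mpr hn')
  rw [Real.log_sqrt hn'.le] at h2
  linarith

lemma tendsto_log_factorial_sub_div {l : ℕ → ℕ} {a : ℝ}
    (hl : Tendsto (fun k : ℕ => (l k : ℝ) / k) atTop (nhds a)) :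
    Tendsto (fun k : ℕ =>
      (Real.log (Nat.factorial (l k)) - ((l k : ℝ) * Real.log (l k) - l k)) / k)
      atTop (nhds 0) := by
  have hinv : Tendsto (fun k : ℕ => 1 / (k : ℝ)) atTop (nhds 0) :=
    tendsto_one_div_atTop_nhds_zero_nat
  have hup : Tendsto (fun k : ℕ => 2 * (√((l k : ℝ) / k) * √(1 / (k : ℝ))) + 1 / (k : ℝ))
      atTop (nhds 0) := by
    have := (((hl.sqrt).mul hinv.sqrt).const_mul 2).add hinv
    simpa using this
  refine squeeze_zero (fun k => ?_) (fun k => ?_) hup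
  · have := mul_log_sub_le_log_factorial (l k)
    exact div_nonneg (by linarith) (Nat.cast_nonneg k)
  · have h := log_factorial_sub_le (l k)
    have hk : √((l k : ℝ) / k) * √(1 / (k : ℝ)) = √(l k) / k := by
      rw [← Real.sqrt_mul (by positivity), div_mul_div_comm, mul_one,
        Real.sqrt_div (Nat.cast_nonneg _), Real.sqrt_mul_self (Nat.cast_nonneg _)]
    rw [hk]
    calc _ ≤ (2 * √(l k) + 1) / (k : ℝ) := by gcongr
      _ = _ := by ring

/-- Exponential growth rate of `(c x) ^ l / l!` when `x ∼ χ k` and `l ∼ a k`. -/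
lemma tendsto_log_pow_div_factorial {x : ℕ → ℝ} {χ : ℝ} (hχ : 0 < χ) (hx : ∀ k, 0 < x k)
    (hxχ : Tendsto (fun k : ℕ => x k / (k : ℝ)) atTop (nhds χ)) {l : ℕ → ℕ} {a : ℝ}
    (hl : Tendsto (fun k : ℕ => (l k : ℝ) / k) atTop (nhds a)) {c : ℝ} (hc : 0 < c) :
    Tendsto (fun k : ℕ => (1 / (k : ℝ)) *
      Real.log ((x k * c) ^ l k / (Nat.factorial (l k) : ℝ)))
      atTop (nhds (a * Real.log (χ * c) - a * Real.log a + a)) := by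
  have hmain : Tendsto (fun k : ℕ => (l k : ℝ) / k * Real.log (x k / k * c) -
      (l k : ℝ) / k * Real.log ((l k : ℝ) / k) + (l k : ℝ) / k -
      (Real.log (Nat.factorial (l k)) - ((l k : ℝ) * Real.log (l k) - l k)) / k)
      atTop (nhds (a * Real.log (χ * c) - a * Real.log a + a - 0)) := by
    refine Tendsto.sub ((Tendsto.sub (hl.mul ?_) ?_).add hl) (tendsto_log_factorial_sub_div hl)
    · exact (hxχ.mul_const c).log (by positivity)
    · exact (Real.continuous_mul_log.tendsto a).comp hl
  rw [sub_zero] at hmain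
  refine hmain.congr' ?_
  filter_upwards [eventually_gt_atTop 0] with k hk
  have hk' : (0 : ℝ) < k := Nat.cast_pos.mpr hk
  have hxk := hx k
  rw [Real.log_div (x := (x k * c) ^ l k) (by positivity) (by positivity), Real.log_pow,
    div_mul_eq_mul_div (x k), Real.log_div (x := x k * c) (by positivity) hk'.ne']
  rcases Nat.eq_zero_or_pos (l k) with h0 | hpos
  · simp [h0]
  · have hp : (0 : ℝ) < l k := Nat.cast_pos.mpr hpos
    rw [Real.log_div hp.ne' hk'.ne']
    field_simp
    ring

/-- Auxiliary tuple: the given entries from index `3` on, and `a`, `b` at indices `1`, `2`. -/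
def consTuple (a b : ℕ) (f : ℕ → ℕ) : ℕ → ℕ
  | 0 => 0
  | 1 => a
  | 2 => b
  | j + 3 => f j

lemma tendsto_log_bellTerm {x : ℕ → ℝ} {χ : ℝ} (hχ : 0 < χ) (hx : ∀ k, 0 < x k)
    (hxχ : Tendsto (fun k : ℕ => x k / (k : ℝ)) atTop (nhds χ)) {l : ℕ → ℕ} {a : ℝ}
    (hl : Tendsto (fun k : ℕ => (l k : ℝ) / k) atTop (nhds a)) {V : ℕ → ℝ} {i : ℕ}
    (hV : 0 < V (i + 1)) :
    Tendsto (fun k : ℕ => (1 / (k : ℝ)) * Real.log (bellTerm V (x k) i (l k))) atTop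
      (nhds (a * Real.log (χ * (V (i + 1) / (Nat.factorial (i + 1) : ℝ))) -
        a * Real.log a + a)) := by
  simp only [bellTerm_eq]
  exact tendsto_log_pow_div_factorial hχ hx hxχ hl (by positivity)

/-- The limiting proportion of jumps of size `i + 1` in the tilted compound Poisson model. -/
def jumpRate (V : ℕ → ℝ) (χ u : ℝ) (i : ℕ) : ℝ :=
  χ * (V (i + 1) * u ^ (i + 1) / (Nat.factorial (i + 1) : ℝ))

lemma jumpRate_nonneg {V : ℕ → ℝ} (hV : ∀ i, 0 ≤ V (i + 1)) {χ u : ℝ} (hχ : 0 < χ) (hu : 0 < u)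
    (i : ℕ) : 0 ≤ jumpRate V χ u i := by
  have := hV i
  unfold jumpRate
  positivity

lemma jumpRate_pos {V : ℕ → ℝ} {χ u : ℝ} (hχ : 0 < χ) (hu : 0 < u) {i : ℕ}
    (hV : 0 < V (i + 1)) : 0 < jumpRate V χ u i := by
  unfold jumpRate
  positivity

lemma jumpRate_mul_log {V : ℕ → ℝ} {χ u : ℝ} (hχ : 0 < χ) (hu : 0 < u) {i : ℕ}
    (hV : 0 < V (i + 1)) :
    jumpRate V χ u i * Real.log (χ * (V (i + 1) / (Nat.factorial (i + 1) : ℝ))) -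
        jumpRate V χ u i * Real.log (jumpRate V χ u i) + jumpRate V χ u i =
      jumpRate V χ u i - (i + 1) * jumpRate V χ u i * Real.log u := by
  have h : jumpRate V χ u i =
      χ * (V (i + 1) / (Nat.factorial (i + 1) : ℝ)) * u ^ (i + 1) := by
    unfold jumpRate
    ring
  have hlog : Real.log (jumpRate V χ u i) =
      Real.log (χ * (V (i + 1) / (Nat.factorial (i + 1) : ℝ))) + (i + 1) * Real.log u := by
    rw [h, Real.log_mul (by positivity) (by positivity), Real.log_pow]
    push_cast
    ring
  rw [hlog]
  ring

lemma tendsto_floor_mul_div {a : ℝ} (ha : 0 ≤ a) :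
    Tendsto (fun k : ℕ => ((⌊a * k⌋₊ : ℕ) : ℝ) / k) atTop (nhds a) :=
  (tendsto_nat_floor_mul_div_atTop ha).comp tendsto_natCast_atTop_atTop

lemma tendsto_log_bellTerm_floor {x : ℕ → ℝ} {χ : ℝ} (hχ : 0 < χ) (hx : ∀ k, 0 < x k)
    (hxχ : Tendsto (fun k : ℕ => x k / (k : ℝ)) atTop (nhds χ)) {V : ℕ → ℝ}
    (hV : ∀ i, 0 ≤ V (i + 1)) {u : ℝ} (hu : 0 < u) (i : ℕ) :
    Tendsto (fun k : ℕ => (1 / (k : ℝ)) *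
        Real.log (bellTerm V (x k) i ⌊jumpRate V χ u i * k⌋₊)) atTop
      (nhds (jumpRate V χ u i - (i + 1) * jumpRate V χ u i * Real.log u)) := by
  rcases (hV i).eq_or_lt with h0 | hpos
  · have : jumpRate V χ u i = 0 := by simp [jumpRate, ← h0]
    simp [this, bellTerm]
  · rw [← jumpRate_mul_log hχ hu hpos]
    exact tendsto_log_bellTerm hχ hx hxχ
      (tendsto_floor_mul_div (jumpRate_nonneg hV hχ hu i)) hpos

lemma bellTerm_pos {V : ℕ → ℝ} {x : ℝ} (hx : 0 < x) {i : ℕ} (hV : 0 < V (i + 1)) (l : ℕ) :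
    0 < bellTerm V x i l := by
  unfold bellTerm
  positivity

lemma bellTerm_floor_pos {V : ℕ → ℝ} (hV : ∀ i, 0 ≤ V (i + 1)) {x : ℝ} (hx : 0 < x)
    (χ u : ℝ) (i k : ℕ) : 0 < bellTerm V x i ⌊jumpRate V χ u i * k⌋₊ := by
  rcases (hV i).eq_or_lt with h0 | hpos
  · have : jumpRate V χ u i = 0 := by simp [jumpRate, ← h0]
    simp [this, bellTerm]
  · exact bellTerm_pos hx hpos _

/-- Lower bound obtained from a single tuple: jumps of size at least `3` occur at their limiting
rates, and jumps of sizes `2` and `3` are used to reach the exact total `k`. -/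
lemma exists_tendsto_le_log_weightedBell {x : ℕ → ℝ} {χ : ℝ} (hχ : 0 < χ) (hx : ∀ k, 0 < x k)
    (hxχ : Tendsto (fun k : ℕ => x k / (k : ℝ)) atTop (nhds χ)) {V : ℕ → ℝ}
    (hV : ∀ i, 0 ≤ V (i + 1)) (hV2 : 0 < V 2) (hV3 : 0 < V 3) {u : ℝ} (hu : 0 < u) (N : ℕ)
    {s : ℝ} (hs : s = 3 * jumpRate V χ u 2 +
      ∑ j ∈ Finset.range N, ((j : ℝ) + 4) * jumpRate V χ u (j + 3)) (hs1 : s < 1) :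
    ∃ g : ℕ → ℝ, Tendsto g atTop (nhds (
        (∑ j ∈ Finset.range N, (jumpRate V χ u (j + 3) -
            ((j + 3 : ℕ) + 1) * jumpRate V χ u (j + 3) * Real.log u)) +
          (jumpRate V χ u 2 - ((2 : ℕ) + 1) * jumpRate V χ u 2 * Real.log u) +
          ((1 - s) / 2 * Real.log (χ * (V (1 + 1) / (Nat.factorial (1 + 1) : ℝ))) -
            (1 - s) / 2 * Real.log ((1 - s) / 2) + (1 - s) / 2) - (Real.log χ + 1))) ∧
      ∀ᶠ k : ℕ in atTop, 0 < weightedBell V k (x k) ∧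
        g k ≤ (1 / (k : ℝ)) * Real.log (weightedBell V k (x k) / x k ^ k) := by
  set lam : ℕ → ℝ := jumpRate V χ u with hlam
  have hlam0 : ∀ i, 0 ≤ lam i := jumpRate_nonneg hV hχ hu
  set S : ℕ → ℕ := fun k => 3 * ⌊lam 2 * k⌋₊ +
    ∑ j ∈ Finset.range N, (j + 4) * ⌊lam (j + 3) * k⌋₊ with hS
  set b : ℕ → ℕ := fun k => (k - S k) % 2 with hb
  set a : ℕ → ℕ := fun k => (k - S k - 3 * b k) / 2 with ha
  have hinv : Tendsto (fun k : ℕ => 1 / (k : ℝ)) atTop (nhds 0) :=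
    tendsto_one_div_atTop_nhds_zero_nat
  have hSlim : Tendsto (fun k : ℕ => (S k : ℝ) / k) atTop (nhds s) := by
    have h1 := ((tendsto_floor_mul_div (hlam0 2)).const_mul 3).add
      (tendsto_finsetSum (Finset.range N) fun j _ =>
        (tendsto_floor_mul_div (hlam0 (j + 3))).const_mul ((j : ℝ) + 4))
    rw [← hs] at h1
    refine h1.congr fun k => ?_
    simp only [hS]
    push_cast
    rw [add_div, Finset.sum_div]
    simp only [mul_div_assoc]
  have hblim : Tendsto (fun k : ℕ => (b k : ℝ) / k) atTop (nhds 0) := by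
    refine squeeze_zero (fun k => by positivity) (fun k => ?_) hinv
    have : b k ≤ 1 := Nat.lt_succ_iff.mp (Nat.mod_lt _ two_pos)
    have : (b k : ℝ) ≤ 1 := by exact_mod_cast this
    gcongr
  have hlarge : ∀ᶠ k : ℕ in atTop, S k + 3 ≤ k := by
    have h1 : Tendsto (fun k : ℕ => (S k : ℝ) / k + 3 * (1 / (k : ℝ))) atTop (nhds (s + 3 * 0)) :=
      hSlim.add (hinv.const_mul 3)
    filter_upwards [h1.eventually_lt_const (by linarith : s + 3 * 0 < 1),
      eventually_gt_atTop 0] with k hk hk0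
    have hk' : (0 : ℝ) < k := Nat.cast_pos.mpr hk0
    rw [mul_one_div, ← add_div, div_lt_one hk'] at hk
    exact_mod_cast hk.le
  have hab : ∀ᶠ k : ℕ in atTop, S k + 2 * a k + 3 * b k = k := by
    filter_upwards [hlarge] with k hk
    simp only [ha, hb]
    omega
  have halim : Tendsto (fun k : ℕ => (a k : ℝ) / k) atTop (nhds ((1 - s) / 2)) := by
    have h1 : Tendsto (fun k : ℕ => (1 - (S k : ℝ) / k - 3 * ((b k : ℝ) / k)) / 2) atTop
        (nhds ((1 - s - 3 * 0) / 2)) :=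
      ((tendsto_const_nhds.sub hSlim).sub (hblim.const_mul 3)).div_const 2
    rw [mul_zero, sub_zero] at h1
    refine h1.congr' ?_
    filter_upwards [hab, eventually_gt_atTop 0] with k hk hk0
    have hk' : (0 : ℝ) < k := Nat.cast_pos.mpr hk0
    have hR : (S k : ℝ) + 2 * a k + 3 * b k = k := by exact_mod_cast hk
    field_simp
    linarith
  have h2lim : Tendsto (fun k : ℕ => ((⌊lam 2 * k⌋₊ + b k : ℕ) : ℝ) / k) atTop
      (nhds (lam 2)) := by
    have := (tendsto_floor_mul_div (hlam0 2)).add hblim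
    rw [add_zero] at this
    refine this.congr fun k => ?_
    push_cast
    ring
  have hlim3 := tendsto_log_bellTerm (i := 2) hχ hx hxχ h2lim hV3
  rw [jumpRate_mul_log (i := 2) hχ hu hV3] at hlim3
  have hlimfac := tendsto_log_pow_div_factorial hχ hx hxχ (l := fun k => k) (a := 1)
    (tendsto_const_nhds.congr' (by
      filter_upwards [eventually_gt_atTop 0] with k hk
      exact (div_self (Nat.cast_ne_zero.mpr hk.ne')).symm)) one_pos
  simp only [mul_one, one_mul, Real.log_one, sub_zero] at hlimfac
  refine ⟨_, (((tendsto_finsetSum (Finset.range N) fun j _ =>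
    tendsto_log_bellTerm_floor hχ hx hxχ hV hu (j + 3)).add hlim3).add
      (tendsto_log_bellTerm (i := 1) hχ hx hxχ halim hV2)).sub hlimfac, ?_⟩
  filter_upwards [hab, eventually_ge_atTop (N + 3)] with k hk hkN
  set l : ℕ → ℕ := consTuple (a k) (⌊lam 2 * k⌋₊ + b k) fun j => ⌊lam (j + 3) * k⌋₊ with hl
  have hlsum : ∑ i ∈ Finset.range (N + 3), (i + 1) * l i = k := by
    rw [Finset.sum_range_succ', Finset.sum_range_succ', Finset.sum_range_succ']
    simp only [hl, consTuple]
    conv_rhs => rw [← hk]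
    simp only [hS]
    ring
  have hxk := hx k
  have hle := prod_bellTerm_le_weightedBell hV hxk.le hkN l hlsum
  rw [Finset.prod_range_succ', Finset.prod_range_succ', Finset.prod_range_succ'] at hle
  simp only [hl, consTuple, zero_add] at hle
  have h0 : bellTerm V (x k) 0 0 = 1 := by simp [bellTerm]
  rw [h0, mul_one] at hle
  have hp1 : 0 < bellTerm V (x k) 1 (a k) := bellTerm_pos hxk hV2 _
  have hp2 : 0 < bellTerm V (x k) (1 + 1) (⌊lam 2 * k⌋₊ + b k) := bellTerm_pos hxk hV3 _
  have hp3 : ∀ j ∈ Finset.range N,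
      0 < bellTerm V (x k) (j + 1 + 1 + 1) ⌊lam (j + 3) * k⌋₊ := fun j _ =>
    bellTerm_floor_pos hV hxk χ u (j + 3) k
  have hp := Finset.prod_pos hp3
  have hpos : 0 < weightedBell V k (x k) := lt_of_lt_of_le (by positivity) hle
  refine ⟨hpos, ?_⟩
  have hlog := Real.log_le_log (by positivity)
    (div_le_div_of_nonneg_right hle (pow_nonneg hxk.le k))
  rw [mul_div_right_comm, Real.log_mul (by positivity) (by positivity), ← inv_div,
    Real.log_inv, Real.log_mul (by positivity) hp1.ne', Real.log_mul hp.ne' hp2.ne',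
    Real.log_prod fun j hj => (hp3 j hj).ne'] at hlog
  have := mul_le_mul_of_nonneg_left hlog (by positivity : (0 : ℝ) ≤ 1 / k)
  refine le_trans (le_of_eq ?_) this
  simp only [← Finset.mul_sum]
  ring

/-- Rate function for weighted Bell polynomials at the solution `u` of the saddle point equation
`∑ i, i V_i u ^ i / i! = 1 / χ`. -/
lemma tendsto_log_weightedBell {x : ℕ → ℝ} {χ : ℝ} (hχ : 0 < χ) (hx : ∀ k, 0 < x k)
    (hxχ : Tendsto (fun k : ℕ => x k / (k : ℝ)) atTop (nhds χ)) {V : ℕ → ℝ}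
    (hV : ∀ i, 0 ≤ V (i + 1)) (hV1 : V 1 = 0) (hV2 : 0 < V 2) (hV3 : 0 < V 3) {u G : ℝ}
    (hu : 0 < u)
    (hG : HasSum (fun i : ℕ => V (i + 1) * u ^ (i + 1) / (Nat.factorial (i + 1) : ℝ)) G)
    (hmean : HasSum (fun i : ℕ => ((i : ℝ) + 1) * jumpRate V χ u i) 1) :
    Tendsto (fun k : ℕ => (1 / (k : ℝ)) * Real.log (weightedBell V k (x k) / x k ^ k)) atTop
      (nhds (χ * G - Real.log u - (Real.log χ + 1))) := by
  set lam : ℕ → ℝ := jumpRate V χ u with hlam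
  have hlam0 : ∀ i, 0 ≤ lam i := jumpRate_nonneg hV hχ hu
  have hlamz : lam 0 = 0 := by simp [hlam, jumpRate, hV1]
  have hlam1 : 0 < lam 1 := jumpRate_pos hχ hu hV2
  have hlamG : HasSum lam (χ * G) := hG.mul_left χ
  set s : ℕ → ℝ := fun N => 3 * lam 2 + ∑ j ∈ Finset.range N, ((j : ℝ) + 4) * lam (j + 3)
    with hs
  have hs_eq : ∀ N, s N =
      ∑ i ∈ Finset.range (N + 3), ((i : ℝ) + 1) * lam i - 2 * lam 1 := fun N => by
    rw [Finset.sum_range_succ', Finset.sum_range_succ', Finset.sum_range_succ']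
    simp only [hs, hlamz]
    push_cast
    norm_num [add_assoc]
    ring
  have hs1 : ∀ N, s N < 1 := fun N => by
    have := sum_le_hasSum (Finset.range (N + 3))
      (fun i _ => mul_nonneg (by positivity) (hlam0 i)) hmean
    rw [hs_eq]
    linarith
  have hslim : Tendsto (fun N => (1 - s N) / 2) atTop (nhds (lam 1)) := by
    have h := (hmean.tendsto_sum_nat.comp (tendsto_add_atTop_nat 3)).sub_const (2 * lam 1)
    have h2 := (h.const_sub 1).div_const 2
    convert! h2 using 2
    · simp [hs_eq]
    · ring
  choose g hg hgle using fun N =>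
    exists_tendsto_le_log_weightedBell hχ hx hxχ hV hV2 hV3 hu N (s := s N) rfl (hs1 N)
  have hpos : ∀ᶠ k : ℕ in atTop, 0 < weightedBell V k (x k) := (hgle 0).mono fun k h => h.1
  have hlimfac := tendsto_log_pow_div_factorial hχ hx hxχ (l := fun k => k) (a := 1)
    (tendsto_const_nhds.congr' (by
      filter_upwards [eventually_gt_atTop 0] with k hk
      exact (div_self (Nat.cast_ne_zero.mpr hk.ne')).symm)) one_pos
  simp only [mul_one, one_mul, Real.log_one, sub_zero] at hlimfac
  refine tendsto_order.mpr ⟨fun c hc => ?_, fun c hc => ?_⟩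
  · have hL : Tendsto (fun N : ℕ => (∑ j ∈ Finset.range N, (lam (j + 3) -
            ((j + 3 : ℕ) + 1) * lam (j + 3) * Real.log u)) +
          (lam 2 - ((2 : ℕ) + 1) * lam 2 * Real.log u) +
          ((1 - s N) / 2 * Real.log (χ * (V (1 + 1) / (Nat.factorial (1 + 1) : ℝ))) -
            (1 - s N) / 2 * Real.log ((1 - s N) / 2) + (1 - s N) / 2) - (Real.log χ + 1)) atTop
        (nhds (χ * G - Real.log u - (Real.log χ + 1))) := by
      have h1 : HasSum (fun j : ℕ => lam j - ((j : ℝ) + 1) * lam j * Real.log u)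
          (χ * G - 1 * Real.log u) := hlamG.sub (hmean.mul_right _)
      have h2 := h1.tendsto_sum_nat.comp (tendsto_add_atTop_nat 3)
      have h3 := ((hslim.mul_const
        (Real.log (χ * (V (1 + 1) / (Nat.factorial (1 + 1) : ℝ))))).sub
          ((Real.continuous_mul_log.tendsto (lam 1)).comp hslim)).add hslim
      rw [hlam, jumpRate_mul_log (i := 1) hχ hu hV2] at h3
      have h4 := ((h2.sub_const (lam 1 - ((1 : ℕ) + 1) * lam 1 * Real.log u)).add h3).sub_const
        (Real.log χ + 1)
      convert! h4 using 2
      · simp only [Function.comp_apply]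
        rw [Finset.sum_range_succ', Finset.sum_range_succ', Finset.sum_range_succ']
        simp only [hlamz, add_assoc, Nat.reduceAdd]
        ring
      · simp only [hlam]
        ring
    obtain ⟨N, hN⟩ := (hL.eventually_const_lt hc).exists
    filter_upwards [(hg N).eventually_const_lt hN, hgle N] with k h1 h2
    exact h1.trans_le h2.2
  · have hup : Tendsto (fun k : ℕ => x k / k * G - Real.log u -
        (1 / (k : ℝ)) * Real.log (x k ^ k / (Nat.factorial k : ℝ))) atTop
        (nhds (χ * G - Real.log u - (Real.log χ + 1))) :=
      ((hxχ.mul_const G).sub_const _).sub hlimfac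
    filter_upwards [hup.eventually_lt_const hc, hpos, eventually_gt_atTop 0] with k h1 hk hk0
    refine lt_of_le_of_lt ?_ h1
    have hxk := hx k
    have hk' : (0 : ℝ) < k := Nat.cast_pos.mpr hk0
    have hpart := sum_le_hasSum (Finset.range k) (fun i _ => by
      have := hV i
      positivity) hG
    have hle := (weightedBell_mul_pow_le hV hxk.le hu.le k).trans
      (mul_le_mul_of_nonneg_left (Real.exp_le_exp.mpr
        (mul_le_mul_of_nonneg_left hpart hxk.le)) (Nat.cast_nonneg _))
    have hlog := Real.log_le_log (by positivity) hle
    rw [Real.log_mul hk.ne' (by positivity), Real.log_mul (by positivity) (by positivity),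
      Real.log_exp, Real.log_pow] at hlog
    rw [Real.log_div hk.ne' (by positivity), Real.log_div (by positivity) (by positivity)]
    have := mul_le_mul_of_nonneg_left hlog (by positivity : (0 : ℝ) ≤ 1 / k)
    have e1 : 1 / (k : ℝ) * (k * Real.log u) = Real.log u := by field_simp
    have e2 : x k / k * G = 1 / (k : ℝ) * (x k * G) := by ring
    rw [mul_add, mul_add, e1] at this
    rw [e2]
    linarith

/-- Theorem 1.2: rate function for the centered compound Poisson moments,
with `H̃(u) = H(u) − u V_1` and `H̃'(u) = H'(u) − V_1`. -/
theorem stmt7 (V : ℕ → ℝ) (hVpos : ∀ i : ℕ, 1 ≤ i → 0 ≤ V i)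
    (hV2 : 0 < V 2) (hV3 : 0 < V 3)
    (u0 : ℝ≥0∞) (hu0 : 0 < u0) (hH : HFinite V u0)
    (χ : ℝ) (hχ : 0 < χ)
    (u : ℝ) (hu : 0 < u) (huu0 : ENNReal.ofReal u < u0)
    (hLambert : u * (weightEGFDeriv V u - V 1) = 1 / χ)
    (x : ℕ → ℝ) (hx : ∀ k, 0 < x k)
    (hxχ : Tendsto (fun k : ℕ => x k / (k : ℝ)) atTop (nhds χ)) :
    Tendsto (fun k : ℕ => (1 / (k : ℝ)) * Real.log (centeredBell V k (x k) / (x k) ^ k))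
      atTop (nhds (((weightEGF V u - u * V 1) - 1) / (u * (weightEGFDeriv V u - V 1)) - 1 +
        Real.log (weightEGFDeriv V u - V 1))) := by
  have hV0 : ∀ i, 0 ≤ V (i + 1) := fun i => hVpos _ (Nat.succ_pos i)
  have hD : weightEGFDeriv V u - V 1 = 1 / (u * χ) := by
    field_simp at hLambert ⊢
    linarith
  have hsumD : Summable fun i : ℕ => V (i + 1) * u ^ i / (Nat.factorial i : ℝ) := by
    by_contra hns
    have h0 : weightEGFDeriv V u = 0 := tsum_eq_zero_of_not_summable hns
    have h1 : 0 < 1 / (u * χ) := by positivity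
    have := hV0 0
    simp only [zero_add] at this
    linarith
  have hGsum := (hH u hu.le huu0).hasSum
  have hDsum : HasSum _ (weightEGFDeriv V u) := hsumD.hasSum
  set W : ℕ → ℝ := Function.update V 1 0 with hW
  have hW0 : ∀ i, 0 ≤ W (i + 1) := fun i => by
    rcases Nat.eq_zero_or_pos i with rfl | hi
    · simp [hW]
    · simp [hW, hi.ne', hV0]
  have hWu : (fun i : ℕ => W (i + 1) * u ^ (i + 1) / (Nat.factorial (i + 1) : ℝ)) =
      Function.update
        (fun i : ℕ => V (i + 1) * u ^ (i + 1) / (Nat.factorial (i + 1) : ℝ)) 0 0 := by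
    funext i
    rcases Nat.eq_zero_or_pos i with rfl | hi
    · simp [hW]
    · simp [hW, hi.ne']
  have hWD : (fun i : ℕ => ((i : ℝ) + 1) * jumpRate W χ u i) = fun i => χ * u *
      Function.update (fun i : ℕ => V (i + 1) * u ^ i / (Nat.factorial i : ℝ)) 0 0 i := by
    funext i
    rcases Nat.eq_zero_or_pos i with rfl | hi
    · simp [hW, jumpRate]
    · have : (Nat.factorial i : ℝ) ≠ 0 := Nat.cast_ne_zero.mpr (Nat.factorial_ne_zero i)
      simp only [jumpRate, hW, ne_eq, hi.ne', not_false_eq_true, Function.update_of_ne,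
        Nat.add_eq_right, Nat.factorial_succ]
      push_cast
      field_simp
      ring
  have hG : HasSum (fun i : ℕ => W (i + 1) * u ^ (i + 1) / (Nat.factorial (i + 1) : ℝ))
      (weightEGF V u - u * V 1 - 1) := by
    rw [hWu]
    convert! hGsum.update 0 0 using 1
    simp only [weightEGF]
    norm_num
    ring
  have hmean : HasSum (fun i : ℕ => ((i : ℝ) + 1) * jumpRate W χ u i) 1 := by
    rw [hWD]
    have h := (hDsum.update 0 0).mul_left (χ * u)
    convert! h using 1
    have : 0 - V (0 + 1) * u ^ 0 / (Nat.factorial 0 : ℝ) + weightEGFDeriv V u =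
        1 / (u * χ) := by
      rw [← hD]
      norm_num
      ring
    rw [this]
    field_simp
  have key := tendsto_log_weightedBell hχ hx hxχ hW0 (by simp [hW]) (by simpa [hW] using hV2)
    (by simpa [hW] using hV3) hu hG hmean
  simp only [centeredBell_eq_weightedBell]
  convert! key using 2
  rw [hLambert, hD, Real.log_div one_ne_zero (by positivity), Real.log_one,
    Real.log_mul hu.ne' hχ.ne']
  field_simp
  ring

end
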